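/- Fix p,β∈ℕ+. There exists a constant C' > 0 depending only on β and p such that for all L,r∈ℕ+ with r ≥ p and rL ≥ 2: sup_{f∈C_u^β([0,1]^p)} inf_{φ̄∈N(r,p,L)} ‖f−φ̄‖_{L^∞([0,1]^p)} ≥ C'·(r²L²·log(rL))^{−β/p}. -/

import Mathlib

open scoped BigOperators
open Matrix

noncomputable section

namespace PromptTF

/-- The ReLU activation function. -/
def relu (x : ℝ) : ℝ := max x 0

/-- The elementary universal activation function (EUAF). -/
def euaf (x : ℝ) : ℝ :=
  if 0 ≤ x then |x - 2 * (⌊(x + 1) / 2⌋ : ℝ)| else x / (1 + |x|)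

/-- Parameters of one transformer layer (attention heads and a feed-forward net). -/
structure TFLayer (D : ℕ) where
  M : ℕ
  Q : Fin M → Matrix (Fin D) (Fin D) ℝ
  K : Fin M → Matrix (Fin D) (Fin D) ℝ
  V : Fin M → Matrix (Fin D) (Fin D) ℝ
  width : ℕ
  W1 : Matrix (Fin width) (Fin D) ℝ
  W2 : Matrix (Fin D) (Fin width) ℝ

/-- Self-attention layer applied to a list of tokens. -/
def attnOut {D : ℕ} (θ : TFLayer D) (H : List (Fin D → ℝ)) : List (Fin D → ℝ) :=
  H.map fun h => fun i =>
    h i + ∑ m : Fin θ.M,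
      (H.map fun h' =>
        relu (dotProduct ((θ.Q m).mulVec h) ((θ.K m).mulVec h')) * ((θ.V m).mulVec h') i).sum

/-- One transformer layer `FFN ∘ Attn`, with feed-forward activation `act`. -/
def layerMap {D : ℕ} (act : ℝ → ℝ) (θ : TFLayer D) (H : List (Fin D → ℝ)) :
    List (Fin D → ℝ) :=
  (attnOut θ H).map fun h => fun i =>
    h i + (θ.W2.mulVec fun k => act ((θ.W1.mulVec h) k)) i

/-- Multi-layer transformer, all activations ReLU. -/
def tfForward {D : ℕ} (Θ : List (TFLayer D)) (H : List (Fin D → ℝ)) : List (Fin D → ℝ) :=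
  Θ.foldl (fun H' θ => layerMap relu θ H') H

/-- Multi-layer transformer whose first feed-forward layer uses the EUAF activation. -/
def tfForwardEUAF {D : ℕ} (Θ : List (TFLayer D)) (H : List (Fin D → ℝ)) :
    List (Fin D → ℝ) :=
  match Θ with
  | [] => H
  | θ :: rest => rest.foldl (fun H' θ' => layerMap relu θ' H') (layerMap euaf θ H)

/-- Sequential (autoregressive) generation: append the last output column repeatedly. -/
def genTokens {D : ℕ} (forward : List (Fin D → ℝ) → List (Fin D → ℝ))
    (H : List (Fin D → ℝ)) : ℕ → List (Fin D → ℝ)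
  | 0 => H
  | v + 1 =>
      genTokens forward H v ++ [(forward (genTokens forward H v)).getLastD (fun _ => 0)]

/-- The token at one-based position `m` in the generated sequence. -/
def tokenAt {D : ℕ} (forward : List (Fin D → ℝ) → List (Fin D → ℝ))
    (H : List (Fin D → ℝ)) (m : ℕ) : Fin D → ℝ :=
  (genTokens forward H (m - H.length)).getD (m - 1) (fun _ => 0)

/-- A token with word embedding `u`, layer index `w`, position `j` and scale `S`:
`(uᵀ, 0_{3d+4}ᵀ, 1, S, S·w, S·j)ᵀ ∈ ℝ^{4d+8}`. -/
def promptToken (d : ℕ) (u : Fin d → ℝ) (w : ℤ) (j : ℕ) (S : ℝ) : Fin (4 * d + 8) → ℝ :=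
  fun i =>
    if h : (i : ℕ) < d then u ⟨i, h⟩
    else if (i : ℕ) = 4 * d + 4 then 1
    else if (i : ℕ) = 4 * d + 5 then S
    else if (i : ℕ) = 4 * d + 6 then S * w
    else if (i : ℕ) = 4 * d + 7 then S * j
    else 0

/-- First `d` coordinates of a token. -/
def firstd (d : ℕ) (h : Fin (4 * d + 8) → ℝ) : Fin d → ℝ :=
  fun k => h (Fin.castLE (by omega) k)

/-- Initial input: `T` prompt tokens followed by `N` data tokens. -/
def initialInput (d T N : ℕ) (u : Fin T → Fin d → ℝ) (w : Fin T → ℕ) (S : ℝ)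
    (z : Fin N → Fin d → ℝ) : List (Fin (4 * d + 8) → ℝ) :=
  ((List.finRange T).map fun j => promptToken d (u j) (w j) ((j : ℕ) + 1) S)
    ++ ((List.finRange N).map fun i => promptToken d (z i) 0 (T + (i : ℕ) + 1) S)

/-- The closed Euclidean ball of radius `B` in `ℝ^d`. -/
def eball (d : ℕ) (B : ℝ) : Set (Fin d → ℝ) :=
  {v | Real.sqrt (∑ k, v k ^ 2) ≤ B}

/-- Data of a valid prompt in `P_U(T, L, S)`: word embeddings in `U`,
layer indices in `{1, …, 2L}`. -/
def ValidPrompt {d : ℕ} (U : Set (Fin d → ℝ)) (T L : ℕ)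
    (u : Fin T → Fin d → ℝ) (w : Fin T → ℕ) : Prop :=
  (∀ j, u j ∈ U) ∧ ∀ j, 1 ≤ w j ∧ w j ≤ 2 * L

/-- The virtual weight matrix `W^P_ℓ` (without the first-layer correction term). -/
def WPmat {d T : ℕ} (u : Fin T → Fin d → ℝ) (w : Fin T → ℕ) (ℓ : ℕ) :
    Matrix (Fin d) (Fin d) ℝ :=
  ∑ j : Fin T,
    if h : (j : ℕ) + 1 < T then
      (if w j = 2 * ℓ - 1 ∧ w ⟨(j : ℕ) + 1, h⟩ = 2 * ℓ then
        vecMulVec (u j) (u ⟨(j : ℕ) + 1, h⟩) else 0)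
    else 0

/-- The first-layer correction term `(h_T)_{1:d} 1{w_T=1} Σ_{j'} (h_{j'})_{1:d}ᵀ 1{w_{j'}=1}`. -/
def WPcorr {d T : ℕ} (u : Fin T → Fin d → ℝ) (w : Fin T → ℕ) :
    Matrix (Fin d) (Fin d) ℝ :=
  if hT : 0 < T then
    (if w ⟨T - 1, by omega⟩ = 1 then
      vecMulVec (u ⟨T - 1, by omega⟩) (∑ j : Fin T, if w j = 1 then u j else 0)
    else 0)
  else 0

/-- The virtual first-layer weight matrix `W^P_{1,i}`; `first` indicates `i = 1`. -/
def WPone {d T : ℕ} (u : Fin T → Fin d → ℝ) (w : Fin T → ℕ) (first : Bool) :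
    Matrix (Fin d) (Fin d) ℝ :=
  WPmat u w 1 + if first then WPcorr u w else 0

/-- The family of virtual weight matrices of a prompt, for the data token with
zero-based index `i`. -/
def WPfam {d T : ℕ} (u : Fin T → Fin d → ℝ) (w : Fin T → ℕ) (i : ℕ) :
    ℕ → Matrix (Fin d) (Fin d) ℝ :=
  fun ℓ => if ℓ = 1 then WPone u w (i == 0) else WPmat u w ℓ

/-- Output of the virtual network after `ℓ` layers:
`vnetOut … ℓ = W_ℓ act(W_{ℓ-1} act( ⋯ act(W_1 z) ⋯ ))`. -/
def vnetOut (d : ℕ) (act : ℝ → ℝ) (Ws : ℕ → Matrix (Fin d) (Fin d) ℝ)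
    (z : Fin d → ℝ) : ℕ → Fin d → ℝ
  | 0 => z
  | ℓ + 1 =>
      (Ws (ℓ + 1)).mulVec fun k =>
        if ℓ = 0 then vnetOut d act Ws z ℓ k else act (vnetOut d act Ws z ℓ k)

/-- The emulation property: for every admissible prompt and data tokens, the sequentially
generated tokens realize the virtual neural network encoded by the prompt
(with activation `act`). -/
def EmulatesWith (d : ℕ)
    (forward : List (Fin (4 * d + 8) → ℝ) → List (Fin (4 * d + 8) → ℝ))
    (act : ℝ → ℝ) : Prop :=
  ∀ B : ℝ, 1 ≤ B → ∀ T L : ℕ, 0 < T → 0 < L →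
  ∀ U : Set (Fin d → ℝ), U ⊆ eball d B →
  ∀ S : ℝ, max ((d : ℝ) * B ^ (4 * L) * (T : ℝ) ^ (2 * L)) (2 * (L : ℝ)) ≤ S →
  ∀ (u : Fin T → Fin d → ℝ) (w : Fin T → ℕ), ValidPrompt U T L u w →
  ∀ N : ℕ, 0 < N → ∀ z : Fin N → Fin d → ℝ, (∀ i k, z i k ∈ Set.Icc (0 : ℝ) 1) →
  ∀ (i : Fin N) (ℓ : ℕ), 1 ≤ ℓ → ℓ ≤ L →
    tokenAt forward (initialInput d T N u w S z) (T + N * ℓ + (i : ℕ) + 1)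
      = promptToken d (vnetOut d act (WPfam u w (i : ℕ)) (z i) ℓ) (-(ℓ : ℤ))
          (T + N * ℓ + (i : ℕ) + 1) S

/-- The embedding `x ↦ (xᵀ, 1, 0_{d-p-1}ᵀ)ᵀ ∈ ℝ^d` of an input `x ∈ ℝ^p`. -/
def embed (d p : ℕ) (x : Fin p → ℝ) : Fin d → ℝ :=
  fun k => if h : (k : ℕ) < p then x ⟨k, h⟩ else if (k : ℕ) = p then 1 else 0

/-- The function approximator `f̂_{Θ,H^P,L,p}`: first coordinate of the token at
position `T+1+L` generated from the prompt followed by the single data token. -/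
def fhat {d : ℕ} (forward : List (Fin (4 * d + 8) → ℝ) → List (Fin (4 * d + 8) → ℝ))
    {T : ℕ} (u : Fin T → Fin d → ℝ) (w : Fin T → ℕ) (S : ℝ) (L p : ℕ)
    (x : Fin p → ℝ) : ℝ :=
  tokenAt forward (initialInput d T 1 u w S fun _ => embed d p x) (T + 1 + L)
    ⟨0, by omega⟩

/-- The unit cube `[0,1]^p`. -/
def unitCube (p : ℕ) : Set (Fin p → ℝ) := Set.Icc 0 1

/-- The sup-distance `‖f - g‖_{L^∞([0,1]^p)}`. -/
def supDist (p : ℕ) (f g : (Fin p → ℝ) → ℝ) : ℝ :=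
  ⨆ x : unitCube p, |f x.1 - g x.1|

/-- Partial derivative (within the unit cube) in coordinate direction `i`. -/
def pderivW (p : ℕ) (i : Fin p) (f : (Fin p → ℝ) → ℝ) : (Fin p → ℝ) → ℝ :=
  fun x => fderivWithin ℝ f (unitCube p) x (Pi.single i 1)

/-- Iterated partial derivative along a list of coordinate directions. -/
def pderivList (p : ℕ) : List (Fin p) → ((Fin p → ℝ) → ℝ) → (Fin p → ℝ) → ℝ
  | [], f => f
  | i :: is, f => pderivList p is (pderivW p i f)

/-- The unit ball `C_u^β([0,1]^p)` of `β`-times continuously differentiable functions with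
all partial derivatives of order `≤ β` bounded by `1` on the cube. -/
def Hclass (p β : ℕ) : Set ((Fin p → ℝ) → ℝ) :=
  {f | ContDiffOn ℝ β f (unitCube p) ∧
    ∀ ls : List (Fin p), ls.length ≤ β →
      ∀ x ∈ unitCube p, |pderivList p ls f x| ≤ 1}

/-- `U_{d,r}` : the span of the first `r` standard basis vectors of `ℝ^d`. -/
def spanFirst (d r : ℕ) : Set (Fin d → ℝ) :=
  {v | ∀ k : Fin d, r ≤ (k : ℕ) → v k = 0}

/-- Hidden layers of a standard ReLU network of width `r` (with biases). -/
def nnHidden {p r : ℕ} (W0 : Matrix (Fin r) (Fin p) ℝ) (b0 : Fin r → ℝ)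
    (Wm : ℕ → Matrix (Fin r) (Fin r) ℝ) (bm : ℕ → Fin r → ℝ) (x : Fin p → ℝ) :
    ℕ → Fin r → ℝ
  | 0 => fun i => W0.mulVec x i + b0 i
  | k + 1 => fun i =>
      (Wm k).mulVec (fun j => relu (nnHidden W0 b0 Wm bm x k j)) i + bm k i

/-- The class `N(r,p,L)` of ReLU networks `ℝ^p → ℝ` of width `r` and depth `L`
(`L` affine maps with ReLU in between). -/
def NNclass (r p L : ℕ) : Set ((Fin p → ℝ) → ℝ) :=
  {f | if L = 1 then ∃ (a : Fin p → ℝ) (b : ℝ), f = fun x => (∑ i, a i * x i) + b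
    else ∃ (W0 : Matrix (Fin r) (Fin p) ℝ) (b0 : Fin r → ℝ)
      (Wm : ℕ → Matrix (Fin r) (Fin r) ℝ) (bm : ℕ → Fin r → ℝ)
      (wL : Fin r → ℝ) (bL : ℝ),
      f = fun x => (∑ j, wL j * relu (nnHidden W0 b0 Wm bm x (L - 2) j)) + bL}

/-- Operator norm (w.r.t. the Euclidean norm) of a `d × d` matrix. -/
def opNorm {d : ℕ} (W : Matrix (Fin d) (Fin d) ℝ) : ℝ :=
  ‖LinearMap.toContinuousLinearMap (Matrix.toEuclideanLin W)‖

/-- The class `W(r,d,U,B)` of coarse weight matrices. -/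
def coarseW (d r : ℕ) (U : Set (Fin d → ℝ)) (B : ℝ) :
    Set (Matrix (Fin d) (Fin d) ℝ) :=
  {W | (∃ ut uu : Fin r → Fin d → ℝ,
        (∀ k, ut k ∈ U) ∧ (∀ k, uu k ∈ U) ∧ W = ∑ k, vecMulVec (ut k) (uu k)) ∧
    opNorm W ≤ B ^ 2}

open Classical in
/-- Number of nonzero parameter entries of one transformer layer. -/
def layerNonzero {D : ℕ} (θ : TFLayer D) : ℕ :=
  (Finset.univ.filter fun p : Fin θ.M × Fin D × Fin D => θ.Q p.1 p.2.1 p.2.2 ≠ 0).card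
  + (Finset.univ.filter fun p : Fin θ.M × Fin D × Fin D => θ.K p.1 p.2.1 p.2.2 ≠ 0).card
  + (Finset.univ.filter fun p : Fin θ.M × Fin D × Fin D => θ.V p.1 p.2.1 p.2.2 ≠ 0).card
  + (Finset.univ.filter fun p : Fin θ.width × Fin D => θ.W1 p.1 p.2 ≠ 0).card
  + (Finset.univ.filter fun p : Fin D × Fin θ.width => θ.W2 p.1 p.2 ≠ 0).card

/-- Total number of nonzero parameter entries of a transformer. -/
def tfNonzero {D : ℕ} (Θ : List (TFLayer D)) : ℕ := (Θ.map layerNonzero).sum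

/-- All parameter entries of one layer bounded in absolute value by `c`. -/
def layerEntriesBounded {D : ℕ} (θ : TFLayer D) (c : ℝ) : Prop :=
  (∀ m i j, |θ.Q m i j| ≤ c) ∧ (∀ m i j, |θ.K m i j| ≤ c) ∧ (∀ m i j, |θ.V m i j| ≤ c)
  ∧ (∀ i j, |θ.W1 i j| ≤ c) ∧ ∀ i j, |θ.W2 i j| ≤ c

end PromptTF
end

open PromptTF Matrix


namespace ReluLowerBound

open MvPolynomial

lemma totalDegree_pderiv_le {σ : Type*} {R : Type*} [CommSemiring R] (i : σ)
    (p : MvPolynomial σ R) : (pderiv i p).totalDegree ≤ p.totalDegree := by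
  classical
  conv_lhs => rw [p.as_sum, map_sum]
  refine (totalDegree_finsetSum _ _).trans (Finset.sup_le fun s hs => ?_)
  rw [pderiv_monomial]
  refine (totalDegree_monomial_le _ _).trans (le_trans ?_ (le_totalDegree hs))
  have h : s - Finsupp.single i 1 ≤ s := tsub_le_self
  exact Finsupp.degree_mono h

/-- The multivariate polynomial with coefficients `c` on exponents in a box vanishes only if
all coefficients do, as soon as it vanishes on a grid of the size of the box. -/
lemma coeff_eq_zero_of_eval_grid {σ : Type*} [Fintype σ] [DecidableEq σ] {k : ℕ}
    (hk : 0 < k) (v : Fin k → ℝ)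
    (hv : Function.Injective v) (c : (σ → Fin k) → ℝ)
    (h : ∀ κ : σ → Fin k, ∑ a : σ → Fin k, c a * ∏ i, v (κ i) ^ (a i : ℕ) = 0) : c = 0 := by
  classical
  let e : (σ → Fin k) → (σ →₀ ℕ) := fun a => Finsupp.equivFunOnFinite.symm fun i => (a i : ℕ)
  have he : Function.Injective e := by
    intro a b hab
    funext i
    exact Fin.ext (DFunLike.congr_fun hab i)
  let P : MvPolynomial σ ℝ := ∑ a, monomial (e a) (c a)
  have hP : P = 0 := by
    refine eq_zero_of_eval_zero_at_prod_finset P (fun _ => Finset.univ.image v) ?_ ?_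
    · intro i
      rw [Finset.card_image_of_injective _ hv, Finset.card_univ, Fintype.card_fin]
      refine (Nat.le_sub_one_iff_lt hk).mp ?_
      rw [degreeOf_le_iff]
      intro m hm
      obtain ⟨a, -, ha⟩ := Finset.mem_biUnion.mp (support_sum hm)
      obtain rfl := Finset.mem_singleton.mp (support_monomial_subset ha)
      have := (a i).2
      simp only [e, Finsupp.equivFunOnFinite_symm_apply_apply]
      omega
    · intro x hx
      simp only [Finset.mem_image, Finset.mem_univ, true_and] at hx
      choose κ hκ using hx
      rw [map_sum, ← h κ]
      refine Finset.sum_congr rfl fun a _ => ?_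
      rw [eval_monomial, Finsupp.prod_fintype _ _ (by simp)]
      simp [e, hκ]
  funext a
  have := congrArg (coeff (e a)) hP
  simpa [P, coeff_sum, coeff_monomial, he.eq_iff] using this

/-- If `k` distinct points `x s y` lie over each point `y` of a `k × ⋯ × k` grid under a
polynomial map of degree at most `D`, then `k` is at most `(1 + D n) ^ n`. -/
lemma card_fiber_le {σ : Type*} [Fintype σ] (D : ℕ) (g : σ → MvPolynomial σ ℝ)
    (hg : ∀ i, (g i).totalDegree ≤ D) (k : ℕ) (v : Fin k → ℝ) (hv : Function.Injective v)
    (x : Fin k → (σ → Fin k) → σ → ℝ)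
    (hx : ∀ s κ i, eval (x s κ) (g i) = v (κ i))
    (hinj : ∀ κ, Function.Injective fun s => x s κ) :
    k ≤ (1 + D * Fintype.card σ) ^ Fintype.card σ := by
  classical
  by_contra! hlt
  obtain ⟨f, hf⟩ := Module.exists_dual_forall_apply_ne_zero (K := ℝ)
    (fun q : {q : Fin k × Fin k × (σ → Fin k) // q.1 ≠ q.2.1} =>
      x q.1.1 q.1.2.2 - x q.1.2.1 q.1.2.2)
    (fun q h0 => q.2 (hinj q.1.2.2 (sub_eq_zero.mp h0)))
  let u : MvPolynomial σ ℝ := ∑ i, C (f (Pi.single i 1)) * X i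
  have hu : ∀ z, eval z u = f z := by
    intro z
    conv_rhs => rw [LinearMap.pi_apply_eq_sum_univ f z]
    simp only [u, map_sum, map_mul, eval_C, eval_X, smul_eq_mul]
    refine Finset.sum_congr rfl fun i _ => ?_
    rw [mul_comm]
    congr 2
    ext j; simp [Pi.single_apply, eq_comm]
  have hudeg : u.totalDegree ≤ 1 := by
    refine (totalDegree_finsetSum _ _).trans (Finset.sup_le fun i _ => ?_)
    refine (totalDegree_mul _ _).trans ?_
    simp
  set n := Fintype.card σ with hn
  have hk : 0 < k := lt_of_le_of_lt (Nat.zero_le _) hlt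
  set T := k - 1 + D * (n * (k - 1)) with hT
  let Q : (Fin k × (σ → Fin k)) → MvPolynomial σ ℝ := fun q =>
    u ^ (q.1 : ℕ) * ∏ i, g i ^ (q.2 i : ℕ)
  have hQ : ∀ q, (Q q).totalDegree ≤ T := by
    intro q
    refine (totalDegree_mul _ _).trans (add_le_add ?_ ?_)
    · refine (totalDegree_pow _ _).trans ?_
      have := q.1.2
      calc (q.1 : ℕ) * u.totalDegree ≤ (q.1 : ℕ) * 1 := Nat.mul_le_mul_left _ hudeg
        _ ≤ k - 1 := by omega
    · refine (totalDegree_finsetProd _ _).trans ?_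
      calc ∑ i, (g i ^ (q.2 i : ℕ)).totalDegree ≤ ∑ _i : σ, (k - 1) * D := by
            refine Finset.sum_le_sum fun i _ => (totalDegree_pow _ _).trans ?_
            have := (q.2 i).2
            exact Nat.mul_le_mul (by omega) (hg i)
        _ = D * (n * (k - 1)) := by simp [hn]; ring
  let Φ : ((Fin k × (σ → Fin k)) → ℝ) →ₗ[ℝ] ((σ → Fin (T + 1)) → ℝ) :=
    Fintype.linearCombination ℝ fun q z => eval (fun i => ((z i : ℕ) : ℝ)) (Q q)
  have hker : LinearMap.ker Φ ≠ ⊥ := by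
    refine LinearMap.ker_ne_bot_of_finrank_lt ?_
    simp only [Module.finrank_fintype_fun_eq_card, Fintype.card_prod, Fintype.card_fun,
      Fintype.card_fin, ← hn]
    have h1 : T + 1 ≤ k * (1 + D * n) := by
      obtain ⟨j, rfl⟩ : ∃ j, k = j + 1 := ⟨k - 1, by omega⟩
      simp only [hT, Nat.add_sub_cancel]
      nlinarith [Nat.zero_le (D * n)]
    calc (T + 1) ^ n ≤ (k * (1 + D * n)) ^ n := Nat.pow_le_pow_left h1 _
      _ = (1 + D * n) ^ n * k ^ n := by rw [mul_pow, mul_comm]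
      _ < k * k ^ n := Nat.mul_lt_mul_of_pos_right hlt (pow_pos hk _)
  obtain ⟨c, hc, hc0⟩ := (Submodule.ne_bot_iff _).mp hker
  apply hc0
  have hzero : ∑ q, C (c q) * Q q = 0 := by
    refine eq_zero_of_eval_zero_at_prod_finset _
      (fun _ => Finset.univ.image fun t : Fin (T + 1) => ((t : ℕ) : ℝ)) ?_ ?_
    · intro i
      rw [Finset.card_image_of_injective _ (fun a b hab => Fin.ext (by exact_mod_cast hab)),
        Finset.card_univ, Fintype.card_fin, Nat.lt_succ_iff]
      refine (degreeOf_le_totalDegree _ _).trans ?_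
      refine (totalDegree_finsetSum _ _).trans (Finset.sup_le fun q _ => ?_)
      refine (totalDegree_mul _ _).trans ?_
      simpa using hQ q
    · intro z hz
      simp only [Finset.mem_image, Finset.mem_univ, true_and] at hz
      choose κ hκ using hz
      have := congrFun (LinearMap.mem_ker.mp hc) κ
      simp only [Φ, Fintype.linearCombination_apply, Finset.sum_apply, Pi.smul_apply,
        smul_eq_mul, Pi.zero_apply, hκ] at this
      simpa [map_sum] using this
  have hvan : ∀ j : Fin k, (fun a => c (j, a)) = 0 := by
    suffices H : ∀ κ : σ → Fin k,
        (fun j : Fin k => ∑ a : σ → Fin k, c (j, a) * ∏ i, v (κ i) ^ (a i : ℕ)) = 0 from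
      fun j => coeff_eq_zero_of_eval_grid hk v hv _ fun κ => congrFun (H κ) j
    intro κ
    refine Matrix.eq_zero_of_forall_index_sum_mul_pow_eq_zero (f := fun s => f (x s κ)) ?_ ?_
    · intro s t hst
      by_contra hne
      refine hf ⟨(s, t, κ), hne⟩ ?_
      simpa [sub_eq_zero] using hst
    · intro s
      have := congrArg (eval (x s κ)) hzero
      simp only [map_sum, map_mul, eval_C, map_zero, Q, map_pow, map_prod, hx, hu,
        Fintype.sum_prod_type] at this
      rw [← this]
      refine Finset.sum_congr rfl fun j _ => ?_
      rw [Finset.sum_mul]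
      exact Finset.sum_congr rfl fun a _ => by ring
  funext q
  exact congrFun (hvan q.1) q.2


lemma hasDerivAt_eval_update {σ : Type*} [DecidableEq σ] (p : MvPolynomial σ ℝ) (x : σ → ℝ)
    (i : σ) :
    HasDerivAt (fun t => eval (Function.update x i t) p) (eval x (pderiv i p)) (x i) := by
  induction p using MvPolynomial.induction_on with
  | C a => simpa using hasDerivAt_const (x i) a
  | add p q hp hq => simpa using hp.fun_add hq
  | mul_X p j hp =>
    have hX : HasDerivAt (fun t => Function.update x i t j) (Pi.single (M := fun _ => ℝ) i 1 j)
        (x i) := by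
      rcases eq_or_ne j i with rfl | hji
      · simpa using hasDerivAt_id' (x j)
      · simpa [hji] using hasDerivAt_const (x i) (x j)
    have heq : (fun t => eval (Function.update x i t) (p * X j)) =
        fun t => eval (Function.update x i t) p * Function.update x i t j := by
      ext t; simp
    rw [heq]
    refine (hp.fun_mul hX).congr_deriv ?_
    · rw [Function.update_eq_self, Derivation.leibniz, pderiv_X, map_add, smul_eq_mul, smul_eq_mul, map_mul, map_mul,
        eval_X]
      rcases eq_or_ne j i with rfl | hji
      · simp; ring
      · simp [hji, mul_comm]

lemma exists_critical_perturbation {σ : Type*} [Fintype σ] (G : MvPolynomial σ ℝ) (z : σ → ℝ)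
    (U K : Set (σ → ℝ)) (hU : IsOpen U) (hUK : U ⊆ K) (hK : IsCompact K) (hz : z ∈ U)
    (hzG : eval z G ≠ 0) (hbd : ∀ x ∈ K, x ∉ U → eval x G = 0) :
    ∃ ε > 0, ∀ y : σ → ℝ, (∀ i, |y i| ≤ ε) → ∃ x ∈ U, ∀ i, eval x (pderiv i G) = y i := by
  classical
  obtain ⟨B, hB⟩ := hK.isBounded.exists_norm_le
  have hB0 : 0 ≤ B := (norm_nonneg z).trans (hB z (hUK hz))
  set a := eval z G with ha
  have ha0 : 0 < |a| := abs_pos.mpr hzG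
  set n : ℝ := (Fintype.card σ : ℝ) with hn
  have hn0 : 0 ≤ n := by positivity
  refine ⟨|a| / (2 * (n * B + 1)), by positivity, fun y hy => ?_⟩
  set ε := |a| / (2 * (n * B + 1)) with hε
  have hlin : ∀ x ∈ K, |∑ i, y i * x i| < |a| / 2 := by
    intro x hx
    calc |∑ i, y i * x i| ≤ ∑ i, |y i * x i| := Finset.abs_sum_le_sum_abs _ _
      _ ≤ ∑ _i : σ, ε * B := by
          refine Finset.sum_le_sum fun i _ => ?_
          rw [abs_mul]
          refine mul_le_mul (hy i) ?_ (abs_nonneg _) (by positivity)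
          exact (norm_le_pi_norm x i).trans (hB x hx)
      _ = ε * (n * B) := by simp [hn]; ring
      _ < ε * (n * B + 1) := by
          have : 0 < ε := by positivity
          nlinarith
      _ = |a| / 2 := by rw [hε]; field_simp
  have hcont : Continuous fun x : σ → ℝ => a * (eval x G - ∑ i, y i * x i) := by
    have := MvPolynomial.continuous_eval G
    fun_prop
  obtain ⟨x, hxK, hmax⟩ := hK.exists_isMaxOn ⟨z, hUK hz⟩ hcont.continuousOn
  have hxU : x ∈ U := by
    by_contra hxU
    have h1 : a * (a - ∑ i, y i * z i) ≤ a * (eval x G - ∑ i, y i * x i) := hmax (hUK hz)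
    rw [hbd x hxK hxU] at h1
    have h2 := hlin x hxK
    have h3 := hlin z (hUK hz)
    have h4 : a * a ≤ a * (∑ i, y i * z i - ∑ i, y i * x i) := by linarith
    have h5 : a * (∑ i, y i * z i - ∑ i, y i * x i) < |a| * |a| := by
      refine (le_abs_self _).trans_lt ?_
      rw [abs_mul]
      refine mul_lt_mul_of_pos_left ?_ ha0
      calc _ ≤ |∑ i, y i * z i| + |∑ i, y i * x i| := abs_sub _ _
        _ < _ := by linarith
    rw [abs_mul_abs_self] at h5
    linarith
  refine ⟨x, hxU, fun i => ?_⟩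
  have hloc : IsLocalMax (fun x : σ → ℝ => a * (eval x G - ∑ i, y i * x i)) x :=
    hmax.isLocalMax (Filter.mem_of_superset (hU.mem_nhds hxU) hUK)
  have hup : Continuous fun t : ℝ => Function.update x i t := by fun_prop
  have hloc' : IsLocalMax ((fun x : σ → ℝ => a * (eval x G - ∑ i, y i * x i)) ∘
      fun t : ℝ => Function.update x i t) (x i) := by
    refine IsLocalMax.comp_continuous (b := x i) ?_ hup.continuousAt
    simpa using hloc
  have hd1 := hasDerivAt_eval_update G x i
  have hd2 := hasDerivAt_eval_update (∑ j, C (y j) * X j) x i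
  have hd := (hd1.fun_sub hd2).const_mul a
  have heq : ((fun x : σ → ℝ => a * (eval x G - ∑ i, y i * x i)) ∘
      fun t : ℝ => Function.update x i t) = fun t => a * (eval (Function.update x i t) G -
        eval (Function.update x i t) (∑ j, C (y j) * X j)) := by
    ext t
    simp
  rw [heq] at hloc'
  have hzero := hloc'.hasDerivAt_eq_zero hd
  have h6 := (mul_eq_zero.mp hzero).resolve_left hzG
  have h7 : eval x (pderiv i (∑ j, C (y j) * X j)) = y i := by
    simp [map_sum, pderiv_X, Pi.single_apply]
  linarith

/-- Points with pairwise different strict sign patterns under `N` polynomials of degree at most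
`d` in `n` variables number at most `(1 + (N d + 2) n) ^ n`. -/
lemma card_strict_sign_patterns_le {σ ι : Type*} [Fintype σ] [Fintype ι] (d : ℕ)
    (F : ι → MvPolynomial σ ℝ) (hF : ∀ i, (F i).totalDegree ≤ d) (k : ℕ) (z : Fin k → σ → ℝ)
    (hz : ∀ t i, eval (z t) (F i) ≠ 0)
    (hne : ∀ s t, s ≠ t → ∃ i, eval (z s) (F i) * eval (z t) (F i) < 0) :
    k ≤ (1 + (Fintype.card ι * d + 2) * Fintype.card σ) ^ Fintype.card σ := by
  classical
  obtain ⟨R, hR⟩ : ∃ R : ℝ, ∀ t, ∑ i, z t i ^ 2 < R := by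
    refine ⟨∑ t, ∑ i, z t i ^ 2 + 1, fun t => ?_⟩
    have := Finset.single_le_sum (f := fun t => ∑ i, z t i ^ 2)
      (fun t _ => Finset.sum_nonneg fun i _ => sq_nonneg _) (Finset.mem_univ t)
    linarith
  let G : MvPolynomial σ ℝ := (C R - ∑ i, X i ^ 2) * ∏ i, F i
  have hGe : ∀ x, eval x G = (R - ∑ i, x i ^ 2) * ∏ i, eval x (F i) := by
    intro x; simp [G, map_prod]
  have hGd : G.totalDegree ≤ Fintype.card ι * d + 2 := by
    refine (totalDegree_mul _ _).trans ?_
    rw [add_comm]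
    refine add_le_add ?_ ?_
    · refine (totalDegree_finsetProd _ _).trans ?_
      refine (Finset.sum_le_sum fun i _ => hF i).trans ?_
      simp
    · refine (totalDegree_sub _ _).trans (max_le (by simp) ?_)
      refine (totalDegree_finsetSum _ _).trans (Finset.sup_le fun i _ => ?_)
      simp
  let U : Fin k → Set (σ → ℝ) := fun t =>
    {x | ∑ i, x i ^ 2 < R} ∩ ⋂ i, {x | 0 < eval x (F i) * eval (z t) (F i)}
  let K : Fin k → Set (σ → ℝ) := fun t =>
    {x | ∑ i, x i ^ 2 ≤ R} ∩ ⋂ i, {x | 0 ≤ eval x (F i) * eval (z t) (F i)}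
  have hcF : ∀ t i, Continuous fun x => eval x (F i) * eval (z t) (F i) := fun t i =>
    (MvPolynomial.continuous_eval (F i)).mul continuous_const
  have hcs : Continuous fun x : σ → ℝ => ∑ i, x i ^ 2 := by fun_prop
  have key : ∀ t, ∃ ε > 0, ∀ y : σ → ℝ, (∀ i, |y i| ≤ ε) →
      ∃ x ∈ U t, ∀ i, eval x (pderiv i G) = y i := by
    intro t
    refine exists_critical_perturbation G (z t) (U t) (K t) ?_ ?_ ?_ ?_ ?_ ?_
    · exact (isOpen_lt hcs continuous_const).inter
        (isOpen_iInter_of_finite fun i => isOpen_lt continuous_const (hcF t i))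
    · exact Set.inter_subset_inter (fun x (hx : _ < R) => le_of_lt (b := R) hx)
        (Set.iInter_mono fun i x (hx : 0 < _) => le_of_lt (a := (0 : ℝ)) hx)
    · refine Metric.isCompact_of_isClosed_isBounded ?_ ?_
      · exact (isClosed_le hcs continuous_const).inter
          (isClosed_iInter fun i => isClosed_le continuous_const (hcF t i))
      · refine isBounded_iff_forall_norm_le.mpr ⟨R + 1, fun x hx => ?_⟩
        have hxR : ∑ i, x i ^ 2 ≤ R := hx.1
        have hR0 : 0 ≤ R := (Finset.sum_nonneg fun i _ => sq_nonneg _).trans hxR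
        refine (pi_norm_le_iff_of_nonneg (by linarith)).mpr fun i => ?_
        have := (Finset.single_le_sum (f := fun i => x i ^ 2) (fun i _ => sq_nonneg _)
          (Finset.mem_univ i)).trans hxR
        rw [Real.norm_eq_abs]
        refine abs_le_of_sq_le_sq ?_ (by linarith)
        nlinarith
    · exact ⟨hR t, Set.mem_iInter.mpr fun i => mul_self_pos.mpr (hz t i)⟩
    · rw [hGe]
      exact mul_ne_zero (sub_pos.mpr (hR t)).ne' (Finset.prod_ne_zero_iff.mpr fun i _ => hz t i)
    · intro x hxK hxU
      rw [hGe]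
      by_contra h0
      obtain ⟨h1, h2⟩ := mul_ne_zero_iff.mp h0
      refine hxU ⟨lt_of_le_of_ne hxK.1 fun h => h1 (sub_eq_zero.mpr h.symm),
        Set.mem_iInter.mpr fun i => ?_⟩
      exact lt_of_le_of_ne (Set.mem_iInter.mp hxK.2 i)
        (mul_ne_zero (Finset.prod_ne_zero_iff.mp h2 i (Finset.mem_univ i)) (hz t i)).symm
  choose ε hε0 hε using key
  obtain ⟨η, hη0, hη⟩ : ∃ η > 0, ∀ t, η ≤ ε t := by
    rcases isEmpty_or_nonempty (Fin k) with h | h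
    · exact ⟨1, one_pos, fun t => h.elim t⟩
    · exact ⟨Finset.univ.inf' Finset.univ_nonempty ε, by simpa using hε0,
        fun t => Finset.inf'_le _ (Finset.mem_univ t)⟩
  let v : Fin k → ℝ := fun j => η * ((j : ℕ) / (k : ℝ))
  have hv : ∀ j, |v j| ≤ η := by
    intro j
    have hj : ((j : ℕ) : ℝ) ≤ k := by exact_mod_cast j.2.le
    have h1 : ((j : ℕ) : ℝ) / k ≤ 1 := div_le_one_of_le₀ hj (by positivity)
    rw [abs_of_nonneg (by positivity)]
    exact mul_le_of_le_one_right hη0.le h1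
  have hvinj : Function.Injective v := by
    intro a b hab
    have hk : (k : ℝ) ≠ 0 := by have := a.pos; positivity
    have h1 := mul_left_cancel₀ hη0.ne' hab
    rw [div_left_inj' hk] at h1
    exact Fin.ext (by exact_mod_cast h1)
  have hsol : ∀ (s : Fin k) (κ : σ → Fin k), ∃ x ∈ U s, ∀ i, eval x (pderiv i G) = v (κ i) :=
    fun s κ => hε s (fun i => v (κ i)) fun i => (hv _).trans (hη s)
  choose x hxU hx using hsol
  refine card_fiber_le _ (fun i => pderiv i G)
    (fun i => (totalDegree_pderiv_le i G).trans hGd) k v hvinj x hx ?_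
  intro κ s t hst
  by_contra hne'
  obtain ⟨i, hi⟩ := hne s t hne'
  have h1 : 0 < eval (x s κ) (F i) * eval (z s) (F i) := Set.mem_iInter.mp (hxU s κ).2 i
  have h2 : 0 < eval (x t κ) (F i) * eval (z t) (F i) := Set.mem_iInter.mp (hxU t κ).2 i
  simp only at hst
  rw [hst] at h1
  nlinarith [mul_pos h1 h2, mul_self_nonneg (eval (x t κ) (F i))]

/-- Points with pairwise different patterns of positivity. -/
lemma card_positivity_patterns_le {σ ι : Type*} [Fintype σ] [Fintype ι] (d : ℕ)
    (F : ι → MvPolynomial σ ℝ) (hF : ∀ i, (F i).totalDegree ≤ d) (k : ℕ) (z : Fin k → σ → ℝ)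
    (hne : Function.Injective fun t i => 0 < eval (z t) (F i)) :
    k ≤ (1 + (Fintype.card ι * d + 2) * Fintype.card σ) ^ Fintype.card σ := by
  classical
  obtain ⟨ε, hε0, hε⟩ : ∃ ε : ℝ, 0 < ε ∧ ∀ t i, 0 < eval (z t) (F i) → ε < eval (z t) (F i) := by
    let S : Finset ℝ := (Finset.univ.image fun q : Fin k × ι => eval (z q.1) (F q.2)).filter (0 < ·)
    rcases S.eq_empty_or_nonempty with h | h
    · refine ⟨1, one_pos, fun t i hti => ?_⟩
      have : eval (z t) (F i) ∈ S :=
        Finset.mem_filter.mpr ⟨Finset.mem_image.mpr ⟨(t, i), Finset.mem_univ _, rfl⟩, hti⟩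
      simp [h] at this
    · have hpos : 0 < S.min' h := (Finset.mem_filter.mp (S.min'_mem h)).2
      refine ⟨S.min' h / 2, by linarith, fun t i hti => ?_⟩
      have : eval (z t) (F i) ∈ S :=
        Finset.mem_filter.mpr ⟨Finset.mem_image.mpr ⟨(t, i), Finset.mem_univ _, rfl⟩, hti⟩
      have := S.min'_le _ this
      linarith
  have hs : ∀ t i, (0 < eval (z t) (F i) ∧ 0 < eval (z t) (F i - C ε)) ∨
      (¬ 0 < eval (z t) (F i) ∧ eval (z t) (F i - C ε) < 0) := by
    intro t i
    simp only [map_sub, eval_C]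
    by_cases h : 0 < eval (z t) (F i)
    · exact Or.inl ⟨h, sub_pos.mpr (hε t i h)⟩
    · exact Or.inr ⟨h, by linarith⟩
  refine card_strict_sign_patterns_le d (fun i => F i - C ε) (fun i => ?_) k z ?_ ?_
  · exact (totalDegree_sub _ _).trans (max_le (hF i) (by simp))
  · intro t i
    rcases hs t i with h | h
    · exact h.2.ne'
    · exact h.2.ne
  · intro s t hst
    obtain ⟨i, hi⟩ := Function.ne_iff.mp (hne.ne hst)
    refine ⟨i, ?_⟩
    rcases hs s i with h | h <;> rcases hs t i with h' | h'
    · simp [h.1, h'.1] at hi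
    · exact mul_neg_of_pos_of_neg h.2 h'.2
    · exact mul_neg_of_neg_of_pos h.2 h'.2
    · simp [h.1, h'.1] at hi

/-- The bound on the number of positivity patterns of `N` polynomials of degree at most `d`
in `n` variables. -/
def patternBound (N d n : ℕ) : ℕ := (1 + (N * d + 2) * n) ^ n

/-- The positivity patterns of a finite family of polynomials are encoded by few labels. -/
lemma exists_encode_positivity {σ ι : Type*} [Fintype σ] [Fintype ι] (d : ℕ)
    (F : ι → MvPolynomial σ ℝ) (hF : ∀ i, (F i).totalDegree ≤ d) :
    ∃ (enc : (σ → ℝ) → Fin (patternBound (Fintype.card ι) d (Fintype.card σ)))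
      (dec : Fin (patternBound (Fintype.card ι) d (Fintype.card σ)) → ι → Prop),
      ∀ x i, dec (enc x) i ↔ 0 < eval x (F i) := by
  classical
  set B := patternBound (Fintype.card ι) d (Fintype.card σ)
  let pat : (σ → ℝ) → ι → Prop := fun x i => 0 < eval x (F i)
  have hcard : Nat.card (Set.range pat) ≤ B := by
    let e := Finite.equivFin (Set.range pat)
    choose z hz using fun t : Fin (Nat.card (Set.range pat)) => (e.symm t).2
    refine card_positivity_patterns_le d F hF _ z ?_
    intro s t hst
    refine e.symm.injective (Subtype.ext ?_)
    rw [← hz s, ← hz t]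
    exact hst
  obtain ⟨emb⟩ : Nonempty (Set.range pat ↪ Fin B) := by
    refine ⟨(Finite.equivFin _).toEmbedding.trans (Fin.castLEEmb hcard)⟩
  have : Nonempty (Set.range pat) := ⟨⟨pat 0, Set.mem_range_self _⟩⟩
  refine ⟨fun x => emb ⟨pat x, Set.mem_range_self x⟩,
    fun b => (Function.invFun emb b).1, fun x i => ?_⟩
  have := Function.leftInverse_invFun emb.injective ⟨pat x, Set.mem_range_self x⟩
  simp only [this, pat]


lemma patternBound_mono {N N' d d' n n' : ℕ} (hN : N ≤ N') (hd : d ≤ d') (hn : n ≤ n') :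
    patternBound N d n ≤ patternBound N' d' n' := by
  unfold patternBound
  calc (1 + (N * d + 2) * n) ^ n ≤ (1 + (N' * d' + 2) * n') ^ n := by gcongr
    _ ≤ (1 + (N' * d' + 2) * n') ^ n' := Nat.pow_le_pow_right (by omega) hn

/-- The functions `h · i` of a parameter `ω` with real coordinates `co ω` are polynomials of
degree at most `d` in these coordinates on each of at most `K` pieces of the parameter space. -/
def PiecewisePoly {Ω σ ι : Type*} (co : Ω → σ → ℝ) (K d : ℕ) (h : Ω → ι → ℝ) : Prop :=
  ∃ (κ : Type) (_ : Fintype κ) (label : Ω → κ) (q : κ → ι → MvPolynomial σ ℝ),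
    Fintype.card κ ≤ K ∧ (∀ c i, (q c i).totalDegree ≤ d) ∧
      ∀ ω i, h ω i = eval (co ω) (q (label ω) i)

namespace PiecewisePoly

variable {Ω σ ι ι' τ : Type*} {co : Ω → σ → ℝ} {K K' d : ℕ}

lemma mono {h : Ω → ι → ℝ} (hh : PiecewisePoly co K d h) (hK : K ≤ K') :
    PiecewisePoly co K' d h := by
  obtain ⟨κ, i, label, q, hc, hr⟩ := hh
  exact ⟨κ, i, label, q, hc.trans hK, hr⟩

lemma const (h : ι → ℝ) : PiecewisePoly co 1 0 fun _ => h :=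
  ⟨Unit, inferInstance, fun _ => (), fun _ i => C (h i), by simp, by simp, by simp⟩

lemma relu [Fintype σ] [Fintype ι] {h : Ω → ι → ℝ} (hh : PiecewisePoly co K d h) :
    PiecewisePoly co (K * patternBound (Fintype.card ι) d (Fintype.card σ)) d
      fun ω i => PromptTF.relu (h ω i) := by
  classical
  obtain ⟨κ, hκ, label, q, hc, hd, he⟩ := hh
  choose enc dec hdec using fun c => exists_encode_positivity d (q c) (hd c)
  refine ⟨κ × Fin (patternBound (Fintype.card ι) d (Fintype.card σ)), inferInstance,
    fun ω => (label ω, enc (label ω) (co ω)),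
    fun c i => if dec c.1 c.2 i then q c.1 i else 0, ?_, ?_, ?_⟩
  · simpa using Nat.mul_le_mul_right _ hc
  · intro c i
    beta_reduce
    split_ifs
    · exact hd _ _
    · simp
  · intro ω i
    have h1 := hdec (label ω) (co ω) i
    beta_reduce
    rw [he ω i, PromptTF.relu]
    split_ifs with h2
    · exact max_eq_left (h1.mp h2).le
    · rw [map_zero]
      exact max_eq_right (not_lt.mp fun h3 => h2 (h1.mpr h3))

lemma affine [Fintype ι] {h : Ω → τ × ι → ℝ} (hh : PiecewisePoly co K d h)
    (w : ι' → ι → σ) (b : ι' → σ) :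
    PiecewisePoly co K (d + 1)
      fun ω (t : τ × ι') => ∑ j, co ω (w t.2 j) * h ω (t.1, j) + co ω (b t.2) := by
  obtain ⟨κ, hκ, label, q, hc, hd, he⟩ := hh
  refine ⟨κ, hκ, label, fun c t => ∑ j, X (w t.2 j) * q c (t.1, j) + X (b t.2), hc, ?_, ?_⟩
  · intro c t
    refine (totalDegree_add _ _).trans (max_le ?_ (by simp))
    refine (totalDegree_finsetSum _ _).trans (Finset.sup_le fun i _ => ?_)
    refine (totalDegree_mul _ _).trans ?_
    rw [totalDegree_X, add_comm]
    exact Nat.add_le_add_right (hd _ _) 1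
  · intro ω t
    simp [he, map_sum]

lemma two_pow_card_le [Fintype σ] [Fintype ι] {h : Ω → ι → ℝ} (hh : PiecewisePoly co K d h)
    (hs : ∀ s : ι → Prop, ∃ ω, ∀ i, s i ↔ 0 < h ω i) :
    2 ^ Fintype.card ι ≤ K * patternBound (Fintype.card ι) d (Fintype.card σ) := by
  classical
  obtain ⟨κ, hκ, label, q, hc, hd, he⟩ := hh
  choose enc dec hdec using fun c => exists_encode_positivity d (q c) (hd c)
  choose ω hω using hs
  have hinj : Function.Injective fun s : ι → Prop =>
      ((label (ω s), enc (label (ω s)) (co (ω s))) :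
        κ × Fin (patternBound (Fintype.card ι) d (Fintype.card σ))) := by
    intro s s' hss
    obtain ⟨h1, h2⟩ := Prod.ext_iff.mp hss
    simp only at h1 h2
    funext i
    rw [eq_iff_iff, hω s i, hω s' i, he, he, ← hdec, ← hdec, ← h1]
    rw [← h1] at h2
    rw [h2]
  have := Fintype.card_le_of_injective _ hinj
  simp only [Fintype.card_pi, Fintype.card_prop, Finset.prod_const, Finset.card_univ,
    Fintype.card_prod, Fintype.card_fin] at this
  exact this.trans (Nat.mul_le_mul_right _ hc)

end PiecewisePoly

/-- If width-`r` depth-`L` ReLU networks realize all positivity patterns on a finite family of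
points, then the number of these points is bounded. -/
lemma two_pow_card_le_of_shatter {p r L : ℕ} (hL : 0 < L) (hr : 0 < r) (hpr : p ≤ r) {ι : Type*}
    [Fintype ι] (x : ι → Fin p → ℝ)
    (hs : ∀ s : ι → Prop, ∃ φ ∈ PromptTF.NNclass r p L, ∀ i, s i ↔ 0 < φ (x i)) :
    2 ^ Fintype.card ι ≤
      patternBound (Fintype.card ι * r) L (2 * L * r ^ 2) ^ L := by
  classical
  set m := Fintype.card ι
  rcases Nat.lt_or_ge L 2 with hL2 | hL2
  · obtain rfl : L = 1 := by omega
    let co : (Fin p → ℝ) × ℝ → (Fin p ⊕ Unit) → ℝ := fun ω => Sum.elim ω.1 fun _ => ω.2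
    have h0 : PiecewisePoly co 1 0 fun _ (t : ι × Fin p) => x t.1 t.2 :=
      PiecewisePoly.const fun t : ι × Fin p => x t.1 t.2
    have h1 := h0.affine (ι' := Unit) (fun _ j => Sum.inl j) fun _ => Sum.inr ()
    have h2 := h1.two_pow_card_le (by
      intro s
      obtain ⟨φ, hφ, hφs⟩ := hs fun i => s (i, ())
      simp only [PromptTF.NNclass, Set.mem_ofPred_eq, if_true] at hφ
      obtain ⟨a, b, rfl⟩ := hφ
      exact ⟨(a, b), fun i => hφs i.1⟩)
    simp only [Fintype.card_prod, Fintype.card_unit, mul_one, one_mul, Fintype.card_sum,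
      Fintype.card_fin, zero_add] at h2
    rw [pow_one]
    refine h2.trans (patternBound_mono (Nat.le_mul_of_pos_right _ hr) le_rfl ?_)
    nlinarith
  · obtain ⟨l, rfl⟩ : ∃ l, L = l + 2 := ⟨L - 2, by omega⟩
    let Ω := Matrix (Fin r) (Fin p) ℝ × (Fin r → ℝ) × (ℕ → Matrix (Fin r) (Fin r) ℝ) ×
      (ℕ → Fin r → ℝ) × (Fin r → ℝ) × ℝ
    let σ := (Fin r × Fin p) ⊕ Fin r ⊕ (Fin l × Fin r × Fin r) ⊕ (Fin l × Fin r) ⊕ Fin r ⊕ Unit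
    let co : Ω → σ → ℝ := fun ω => Sum.elim (fun q => ω.1 q.1 q.2) <| Sum.elim ω.2.1 <|
      Sum.elim (fun q => ω.2.2.1 q.1 q.2.1 q.2.2) <| Sum.elim (fun q => ω.2.2.2.1 q.1 q.2) <|
      Sum.elim ω.2.2.2.2.1 fun _ => ω.2.2.2.2.2
    set B := patternBound (m * r) (l + 2) (2 * (l + 2) * r ^ 2) with hB
    have hσ : Fintype.card σ ≤ 2 * (l + 2) * r ^ 2 := by
      simp only [σ, Fintype.card_sum, Fintype.card_prod, Fintype.card_fin, Fintype.card_unit]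
      have h1 : r ≤ r * r := Nat.le_mul_of_pos_left _ hr
      have h2 : r * p ≤ r * r := Nat.mul_le_mul_left _ hpr
      have h3 : l * r ≤ l * (r * r) := Nat.mul_le_mul_left _ h1
      nlinarith
    have hcard : Fintype.card (ι × Fin r) = m * r := by simp [m]
    have hrelu : ∀ {K d : ℕ} {h : Ω → ι × Fin r → ℝ}, d ≤ l + 2 → PiecewisePoly co K d h →
        PiecewisePoly co (K * B) d fun ω i => PromptTF.relu (h ω i) := by
      intro K d h hd hh
      exact hh.relu.mono (Nat.mul_le_mul_left _ (patternBound_mono hcard.le hd hσ))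
    have hlayer : ∀ k ≤ l, PiecewisePoly co (B ^ k) (k + 1)
        fun ω (t : ι × Fin r) =>
          PromptTF.nnHidden ω.1 ω.2.1 ω.2.2.1 ω.2.2.2.1 (x t.1) k t.2 := by
      intro k
      induction k with
      | zero =>
        intro _
        have h0 : PiecewisePoly co 1 0 fun _ (t : ι × Fin p) => x t.1 t.2 :=
          PiecewisePoly.const fun t : ι × Fin p => x t.1 t.2
        exact h0.affine (fun i j => Sum.inl (i, j)) fun i : Fin r => Sum.inr (Sum.inl i)
      | succ k ih =>
        intro hk
        have h1 := hrelu (by omega) (ih (by omega))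
        rw [pow_succ]
        exact h1.affine (fun i j => Sum.inr (Sum.inr (Sum.inl (⟨k, hk⟩, i, j))))
          fun i : Fin r => Sum.inr (Sum.inr (Sum.inr (Sum.inl (⟨k, hk⟩, i))))
    have h1 := hrelu (by omega) (hlayer l le_rfl)
    have h2 := h1.affine (ι' := Unit)
      (fun _ j => Sum.inr (Sum.inr (Sum.inr (Sum.inr (Sum.inl j)))))
      fun _ => Sum.inr (Sum.inr (Sum.inr (Sum.inr (Sum.inr ()))))
    have h3 := h2.two_pow_card_le (by
      intro s
      obtain ⟨φ, hφ, hφs⟩ := hs fun i => s (i, ())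
      rw [PromptTF.NNclass, Set.mem_ofPred_eq, if_neg (by omega)] at hφ
      obtain ⟨W0, b0, Wm, bm, wL, bL, rfl⟩ := hφ
      exact ⟨(W0, b0, Wm, bm, wL, bL), fun i => hφs i.1⟩)
    simp only [Fintype.card_prod, Fintype.card_unit, mul_one] at h3
    refine h3.trans ?_
    rw [pow_succ, pow_succ]
    exact Nat.mul_le_mul_left _ (patternBound_mono (Nat.le_mul_of_pos_right _ hr) le_rfl hσ)

end ReluLowerBound

namespace ReluLowerBound

open scoped ContDiff

variable {p : ℕ}

/-- Iterated partial derivatives on the whole space. -/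
noncomputable def partialList : List (Fin p) → ((Fin p → ℝ) → ℝ) → (Fin p → ℝ) → ℝ
  | [], f => f
  | i :: is, f => partialList is fun x => fderiv ℝ f x (Pi.single i 1)

lemma uniqueDiffOn_unitCube : UniqueDiffOn ℝ (PromptTF.unitCube p) := by
  rw [PromptTF.unitCube, ← Set.pi_univ_Icc]
  exact UniqueDiffOn.univ_pi fun i => uniqueDiffOn_Icc (by simp)

lemma pderivList_congr (ls : List (Fin p)) {f g : (Fin p → ℝ) → ℝ}
    (h : Set.EqOn f g (PromptTF.unitCube p)) :
    Set.EqOn (PromptTF.pderivList p ls f) (PromptTF.pderivList p ls g)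
      (PromptTF.unitCube p) := by
  induction ls generalizing f g with
  | nil => exact h
  | cons i is ih =>
    refine ih fun x hx => ?_
    rw [PromptTF.pderivW, PromptTF.pderivW, fderivWithin_congr h (h hx)]

lemma partialList_contDiff_tsupport (ls : List (Fin p)) {g : (Fin p → ℝ) → ℝ}
    (hg : ContDiff ℝ ∞ g) :
    ContDiff ℝ ∞ (partialList ls g) ∧ tsupport (partialList ls g) ⊆ tsupport g := by
  induction ls generalizing g with
  | nil => exact ⟨hg, subset_rfl⟩
  | cons i is ih =>
    have h1 : ContDiff ℝ ∞ fun x => fderiv ℝ g x (Pi.single i 1) :=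
      (hg.fderiv_right (m := ∞) (by simp)).clm_apply contDiff_const
    obtain ⟨h2, h3⟩ := ih h1
    exact ⟨h2, h3.trans (tsupport_fderiv_apply_subset ℝ _)⟩

/-- A weighted sum of translates of `g`, dilated by `k`. -/
noncomputable def bumpSum {ι : Type*} [Fintype ι] (k : ℝ) (c : ι → Fin p → ℝ) (g : (Fin p → ℝ) → ℝ)
    (w : ι → ℝ) (x : Fin p → ℝ) : ℝ :=
  ∑ j, w j * g (k • x - c j)

section bumpSum

variable {ι : Type*} [Fintype ι] (k : ℝ) (c : ι → Fin p → ℝ)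

lemma contDiff_bumpSum {g : (Fin p → ℝ) → ℝ} (hg : ContDiff ℝ ∞ g) (w : ι → ℝ) :
    ContDiff ℝ ∞ (bumpSum k c g w) := by
  unfold bumpSum
  refine ContDiff.sum fun j _ => contDiff_const.mul (hg.comp ?_)
  fun_prop

lemma pderivW_bumpSum {g : (Fin p → ℝ) → ℝ} (hg : ContDiff ℝ ∞ g) (w : ι → ℝ) (i : Fin p)
    {x : Fin p → ℝ} (hx : x ∈ PromptTF.unitCube p) :
    PromptTF.pderivW p i (bumpSum k c g w) x =
      bumpSum k c (fun x => fderiv ℝ g x (Pi.single i 1)) (fun j => k * w j) x := by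
  have hgd : Differentiable ℝ g := hg.differentiable (by simp)
  have h1 : HasFDerivAt (bumpSum k c g w) (∑ j, w j • ((fderiv ℝ g (k • x - c j)).comp
      (k • ContinuousLinearMap.id ℝ (Fin p → ℝ)))) x := by
    unfold bumpSum
    refine HasFDerivAt.fun_sum fun j _ => HasFDerivAt.const_mul ?_ (w j)
    refine (hgd _).hasFDerivAt.comp x ?_
    exact ((hasFDerivAt_id x).const_smul k).sub_const (c j)
  rw [PromptTF.pderivW, h1.hasFDerivWithinAt.fderivWithin (uniqueDiffOn_unitCube x hx), bumpSum]
  simp only [_root_.sum_apply, _root_.smul_apply,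
    ContinuousLinearMap.comp_apply, ContinuousLinearMap.id_apply, map_smul, smul_eq_mul]
  exact Finset.sum_congr rfl fun j _ => by ring

lemma pderivList_bumpSum (ls : List (Fin p)) {g : (Fin p → ℝ) → ℝ} (hg : ContDiff ℝ ∞ g)
    (w : ι → ℝ) {x : Fin p → ℝ} (hx : x ∈ PromptTF.unitCube p) :
    PromptTF.pderivList p ls (bumpSum k c g w) x =
      bumpSum k c (partialList ls g) (fun j => k ^ ls.length * w j) x := by
  induction ls generalizing g w with
  | nil => simp [PromptTF.pderivList, partialList]
  | cons i is ih =>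
    rw [PromptTF.pderivList, pderivList_congr is
      (fun y hy => pderivW_bumpSum k c hg w i hy) hx, ih
      ((hg.fderiv_right (m := ∞) (by simp)).clm_apply contDiff_const), partialList]
    simp only [List.length_cons, pow_succ, mul_assoc]

lemma abs_bumpSum_le {g : (Fin p → ℝ) → ℝ} {M W : ℝ} (hgM : ∀ x, |g x| ≤ M) (hW : 0 ≤ W)
    (w : ι → ℝ) (hw : ∀ j, |w j| ≤ W) (x : Fin p → ℝ)
    (hdisj : ∀ j j', g (k • x - c j) ≠ 0 → g (k • x - c j') ≠ 0 → j = j') :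
    |bumpSum k c g w x| ≤ W * M := by
  classical
  unfold bumpSum
  by_cases h : ∃ j, g (k • x - c j) ≠ 0
  · obtain ⟨j, hj⟩ := h
    rw [Finset.sum_eq_single j]
    · rw [abs_mul]
      exact mul_le_mul (hw j) (hgM _) (abs_nonneg _) hW
    · intro j' _ hne
      by_contra h0
      exact hne (hdisj j' j (right_ne_zero_of_mul h0) hj)
    · simp
  · push Not at h
    have hM : 0 ≤ M := (abs_nonneg _).trans (hgM 0)
    simp only [h, mul_zero, Finset.sum_const_zero, abs_zero]
    positivity

end bumpSum

/-- Centers of the cells of the `k × ⋯ × k` grid of unit cells. -/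
noncomputable def cellCenter {k : ℕ} (j : Fin p → Fin k) : Fin p → ℝ := fun i => (j i : ℕ) + 1 / 2

lemma cellCenter_separated {k : ℕ} {j j' : Fin p → Fin k} {y : Fin p → ℝ}
    (h : y - cellCenter j ∈ Metric.closedBall (0 : Fin p → ℝ) (1 / 3))
    (h' : y - cellCenter j' ∈ Metric.closedBall (0 : Fin p → ℝ) (1 / 3)) : j = j' := by
  rw [mem_closedBall_zero_iff] at h h'
  funext i
  have h1 := abs_le.mp ((norm_le_pi_norm _ i).trans h)
  have h2 := abs_le.mp ((norm_le_pi_norm _ i).trans h')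
  simp only [Pi.sub_apply, cellCenter] at h1 h2
  refine Fin.ext ?_
  have h3 : ((j i : ℕ) : ℝ) < (j' i : ℕ) + 1 := by linarith [h1.1, h1.2, h2.1, h2.2]
  have h4 : ((j' i : ℕ) : ℝ) < (j i : ℕ) + 1 := by linarith [h1.1, h1.2, h2.1, h2.2]
  have h5 : (j i : ℕ) < (j' i : ℕ) + 1 := by exact_mod_cast h3
  have h6 : (j' i : ℕ) < (j i : ℕ) + 1 := by exact_mod_cast h4
  omega

lemma smul_cellCenter_mem {k : ℕ} (j : Fin p → Fin k) :
    (k : ℝ)⁻¹ • cellCenter j ∈ PromptTF.unitCube p := by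
  have h (i : Fin p) : 0 ≤ (k : ℝ)⁻¹ * ((j i : ℕ) + 1 / 2) ∧
      (k : ℝ)⁻¹ * ((j i : ℕ) + 1 / 2) ≤ 1 := by
    have h1 : (0 : ℝ) < k := by exact_mod_cast (j i).pos
    have h2 : ((j i : ℕ) : ℝ) + 1 ≤ k := by exact_mod_cast (j i).2
    refine ⟨by positivity, ?_⟩
    rw [inv_mul_le_one₀ h1]
    linarith
  exact ⟨fun i => (h i).1, fun i => (h i).2⟩

/-- The class `C_u^β` contains functions with arbitrary signs and values of size `k ^ (-β)` at the
cell centers of a regular grid with `k ^ p` cells. -/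
lemma exists_mem_Hclass (p β : ℕ) :
    ∃ a : ℝ, 0 < a ∧ ∀ k : ℕ, 0 < k → ∀ s : (Fin p → Fin k) → ℝ, (∀ j, |s j| ≤ 1) →
      ∃ f ∈ PromptTF.Hclass p β,
        ∀ j, f ((k : ℝ)⁻¹ • cellCenter j) = s j * (a / (k : ℝ) ^ β) := by
  classical
  let ψ : ContDiffBump (0 : Fin p → ℝ) := ⟨1 / 4, 1 / 3, by norm_num, by norm_num⟩
  have hψ : ContDiff ℝ ∞ (ψ : (Fin p → ℝ) → ℝ) := ψ.contDiff
  have hsupp : tsupport (ψ : (Fin p → ℝ) → ℝ) = Metric.closedBall 0 (1 / 3) := ψ.tsupport_eq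
  have hzero : ∀ ls : List (Fin p), ∀ x, partialList ls ψ x ≠ 0 →
      x ∈ Metric.closedBall (0 : Fin p → ℝ) (1 / 3) := by
    intro ls x hx
    rw [← hsupp]
    exact (partialList_contDiff_tsupport ls hψ).2 (subset_tsupport _ hx)
  have hbound : ∀ ls : List (Fin p), ∃ M : ℝ, ∀ x, |partialList ls ψ x| ≤ M := by
    intro ls
    obtain ⟨h1, h2⟩ := partialList_contDiff_tsupport ls hψ
    have h3 : HasCompactSupport (partialList ls ψ) :=
      ψ.hasCompactSupport.of_isClosed_subset (isClosed_tsupport _) h2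
    exact h3.exists_bound_of_continuous h1.continuous
  choose M hM using hbound
  obtain ⟨M', hM'⟩ := ((List.finite_length_le (Fin p) β).image M).bddAbove
  have hpos : 0 < max M' 1 := lt_max_of_lt_right one_pos
  refine ⟨(max M' 1)⁻¹, inv_pos.mpr hpos, fun k hk s hs => ?_⟩
  have hk0 : (0 : ℝ) < k := by exact_mod_cast hk
  set A := (max M' 1)⁻¹ / (k : ℝ) ^ β with hA
  have hA0 : 0 < A := by positivity
  refine ⟨bumpSum k cellCenter ψ fun j => s j * A, ⟨?_, ?_⟩, ?_⟩
  · exact ((contDiff_bumpSum _ _ hψ _).of_le (by exact_mod_cast le_top)).contDiffOn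
  · intro ls hls x hx
    rw [pderivList_bumpSum _ _ ls hψ _ hx]
    refine (abs_bumpSum_le (M := max M' 1) (W := (k : ℝ) ^ β * A) _ _ ?_ (by positivity) _ ?_ x
      ?_).trans ?_
    · exact fun y => (hM ls y).trans ((hM' (Set.mem_image_of_mem M hls)).trans (le_max_left _ _))
    · intro j
      rw [abs_mul, abs_mul, abs_of_pos hA0, abs_of_nonneg (by positivity)]
      refine mul_le_mul ?_ (mul_le_of_le_one_left hA0.le (hs j)) (by positivity) (by positivity)
      exact pow_le_pow_right₀ (by exact_mod_cast hk) hls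
    · exact fun j j' h h' => cellCenter_separated (hzero ls _ h) (hzero ls _ h')
    · rw [hA]
      refine le_of_eq ?_
      field_simp
  · intro j
    have hsm : (k : ℝ) • ((k : ℝ)⁻¹ • cellCenter j) = cellCenter j := by
      rw [smul_smul, mul_inv_cancel₀ hk0.ne', one_smul]
    rw [bumpSum, hsm, Finset.sum_eq_single j]
    · rw [sub_self, ψ.one_of_mem_closedBall (Metric.mem_closedBall_self ψ.rIn_pos.le), mul_one]
    · intro j' _ hne
      by_contra h0
      have h1 := hzero [] _ (right_ne_zero_of_mul h0)
      exact hne (cellCenter_separated h1 (by simp))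
    · simp

end ReluLowerBound

namespace ReluLowerBound

open PromptTF

lemma card_le_of_shatter {r L m : ℕ} (hw : 2 ≤ r * L) (hm : 0 < m)
    (h : 2 ^ m ≤ patternBound (m * r) L (2 * L * r ^ 2) ^ L) :
    (m : ℝ) ≤ 60 * (r ^ 2 * L ^ 2 * Real.log (r * L)) := by
  have hL : 0 < L := Nat.pos_of_ne_zero fun h0 => by simp [h0] at hw
  set v := r * L with hv
  have hbase : 1 + (m * r * L + 2) * (2 * L * r ^ 2) ≤ m * v ^ 6 := by
    have h1 : 2 * L * r ^ 2 ≤ 2 * v ^ 2 := by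
      rw [hv]; nlinarith [Nat.mul_le_mul_left (r ^ 2 * L) hL]
    calc 1 + (m * r * L + 2) * (2 * L * r ^ 2) ≤ 1 + (m * r * L + 2) * (2 * v ^ 2) := by gcongr
      _ = 1 + 2 * m * v ^ 3 + 4 * v ^ 2 := by rw [hv]; ring
      _ ≤ m * v ^ 3 + 2 * m * v ^ 3 + 2 * m * v ^ 3 := by
          have h2 : 1 ≤ m * v ^ 3 := Nat.mul_pos hm (by positivity)
          have h3 : 2 * v ^ 2 ≤ m * v ^ 3 := by
            calc 2 * v ^ 2 ≤ v * v ^ 2 := by gcongr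
              _ = 1 * v ^ 3 := by ring
              _ ≤ m * v ^ 3 := by gcongr; omega
          linarith
      _ = 5 * (m * v ^ 3) := by ring
      _ ≤ v ^ 3 * (m * v ^ 3) := by
          gcongr
          calc 5 ≤ 2 ^ 3 := by norm_num
            _ ≤ v ^ 3 := by gcongr
      _ = m * v ^ 6 := by ring
  have h1 : 2 ^ m ≤ (m * v ^ 6) ^ (2 * v ^ 2) := by
    calc 2 ^ m ≤ ((1 + (m * r * L + 2) * (2 * L * r ^ 2)) ^ (2 * L * r ^ 2)) ^ L := h
      _ ≤ ((m * v ^ 6) ^ (2 * L * r ^ 2)) ^ L := by gcongr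
      _ = (m * v ^ 6) ^ (2 * v ^ 2) := by rw [← pow_mul, hv]; ring_nf
  have hv0 : (0 : ℝ) < v := by positivity
  have hm0 : (0 : ℝ) < m := by exact_mod_cast hm
  have h2 : (m : ℝ) * Real.log 2 ≤ 2 * v ^ 2 * (Real.log m + 6 * Real.log v) := by
    have := Real.log_le_log (by positivity) (show ((2 : ℝ) ^ m) ≤ (m * v ^ 6) ^ (2 * v ^ 2) by
      exact_mod_cast h1)
    rw [Real.log_pow, Real.log_pow, Real.log_mul hm0.ne' (by positivity), Real.log_pow] at this
    push_cast at this
    linarith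
  have hlog2 : Real.log 2 ≤ Real.log v := Real.log_le_log two_pos (by exact_mod_cast hw)
  have h3 : Real.log m ≤ m / (8 * v ^ 2) + 5 * Real.log v := by
    have h4 : Real.log (m / (8 * v ^ 2)) ≤ m / (8 * v ^ 2) :=
      (Real.log_le_sub_one_of_pos (by positivity)).trans (by linarith)
    rw [Real.log_div hm0.ne' (by positivity), Real.log_mul (by norm_num) (by positivity),
      show (8 : ℝ) = 2 ^ 3 by norm_num, Real.log_pow, Real.log_pow] at h4
    norm_num at h4 ⊢
    linarith
  have h5 : (m : ℝ) * Real.log 2 ≤ m / 4 + 22 * (v ^ 2 * Real.log v) := by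
    refine h2.trans ?_
    calc 2 * (v : ℝ) ^ 2 * (Real.log m + 6 * Real.log v)
        ≤ 2 * v ^ 2 * (m / (8 * v ^ 2) + 5 * Real.log v + 6 * Real.log v) := by gcongr
      _ = m / 4 + 22 * (v ^ 2 * Real.log v) := by field_simp; ring
  have h6 := Real.log_two_gt_d9
  have h7 : (m : ℝ) * 0.69 ≤ m * Real.log 2 := by gcongr; linarith
  have h8 : (0 : ℝ) ≤ v ^ 2 * Real.log v := by
    have : 0 ≤ Real.log (v : ℝ) := by linarith
    positivity
  have h9 : (r : ℝ) ^ 2 * L ^ 2 * Real.log (r * L) = v ^ 2 * Real.log v := by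
    rw [hv]; push_cast; ring
  rw [h9]
  linarith

lemma continuous_of_mem_NNclass {r p L : ℕ} {φ : (Fin p → ℝ) → ℝ} (hφ : φ ∈ NNclass r p L) :
    Continuous φ := by
  rw [NNclass, Set.mem_ofPred_eq] at hφ
  split_ifs at hφ with hL
  · obtain ⟨a, b, rfl⟩ := hφ
    fun_prop
  · obtain ⟨W0, b0, Wm, bm, wL, bL, rfl⟩ := hφ
    have hrelu : Continuous relu := by unfold relu; fun_prop
    have h : ∀ k j, Continuous fun x => nnHidden W0 b0 Wm bm x k j := by
      intro k
      induction k with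
      | zero =>
        intro j
        simp only [nnHidden, Matrix.mulVec, dotProduct]
        fun_prop
      | succ k ih =>
        intro j
        simp only [nnHidden, Matrix.mulVec, dotProduct]
        fun_prop
    fun_prop

lemma abs_sub_le_supDist {p : ℕ} {f φ : (Fin p → ℝ) → ℝ} (hf : ContinuousOn f (unitCube p))
    (hφ : Continuous φ) {x : Fin p → ℝ} (hx : x ∈ unitCube p) :
    |f x - φ x| ≤ supDist p f φ := by
  have hcompact : IsCompact (unitCube p) := isCompact_Icc
  have hbdd := (hcompact.image_of_continuousOn (hf.sub hφ.continuousOn).abs).bddAbove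
  refine le_ciSup (f := fun x : unitCube p => |f x.1 - φ x.1|) ?_ ⟨x, hx⟩
  rwa [Set.image_eq_range] at hbdd

/-- Sign patterns of size `a / k ^ β` on a grid with many points cannot all be approximated. -/
lemma exists_le_supDist {p β r L k : ℕ} {a : ℝ} (hL : 0 < L) (hr : 0 < r) (hpr : p ≤ r)
    (hw : 2 ≤ r * L) (hk : 0 < k)
    (ha : ∀ s : (Fin p → Fin k) → ℝ, (∀ j, |s j| ≤ 1) → ∃ f ∈ Hclass p β,
        ∀ j, f ((k : ℝ)⁻¹ • cellCenter j) = s j * (a / (k : ℝ) ^ β))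
    (hbig : 60 * ((r : ℝ) ^ 2 * L ^ 2 * Real.log (r * L)) < (k : ℝ) ^ p) :
    ∃ f ∈ Hclass p β, ∀ φ ∈ NNclass r p L, a / (k : ℝ) ^ β ≤ supDist p f φ := by
  classical
  by_contra! hcon
  have hsh := two_pow_card_le_of_shatter hL hr hpr (ι := Fin p → Fin k)
    (fun j => (k : ℝ)⁻¹ • cellCenter j) (by
      intro s
      obtain ⟨f, hf, hfs⟩ := ha (fun j => if s j then 1 else -1) (by
        intro j; split_ifs <;> simp)
      obtain ⟨φ, hφ, hlt⟩ := hcon f hf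
      refine ⟨φ, hφ, fun j => ?_⟩
      have h1 := (abs_sub_le_supDist hf.1.continuousOn (continuous_of_mem_NNclass hφ)
        (smul_cellCenter_mem j)).trans_lt hlt
      rw [hfs j, abs_lt] at h1
      by_cases hsj : s j
      · simp only [hsj, if_true, true_iff] at h1 ⊢
        linarith
      · simp only [hsj, if_false, false_iff, not_lt] at h1 ⊢
        linarith)
  simp only [Fintype.card_fun, Fintype.card_fin] at hsh
  have := card_le_of_shatter hw (pow_pos hk p) hsh
  push_cast at this
  linarith

end ReluLowerBound

/-- Lower bound for approximation of `C_u^β([0,1]^p)` by ReLU networks of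
width `r` and depth `L`:
`sup_{f ∈ C_u^β} inf_{φ̄ ∈ N(r,p,L)} ‖f − φ̄‖_∞ ≥ C'·(r²L²·log(rL))^{−β/p}`. -/
theorem statement_2 (p β : ℕ) (hp : 0 < p) (hβ : 0 < β) :
    ∃ C' : ℝ, 0 < C' ∧
      ∀ L r : ℕ, 0 < L → 0 < r → p ≤ r → 2 ≤ r * L →
        ∀ δ : ℝ, 0 < δ →
          ∃ f ∈ Hclass p β, ∀ φ ∈ NNclass r p L,
            C' * (((r : ℝ) ^ 2 * (L : ℝ) ^ 2 * Real.log ((r : ℝ) * (L : ℝ)))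
                ^ (-(β : ℝ) / (p : ℝ))) - δ
              ≤ supDist p f φ := by
  obtain ⟨a, ha0, ha⟩ := ReluLowerBound.exists_mem_Hclass p β
  have hp0 : (0 : ℝ) < p := by exact_mod_cast hp
  refine ⟨a / 2 ^ β * (60 : ℝ) ^ (-(β : ℝ) / p), by positivity, ?_⟩
  intro L r hL hr hpr hw δ hδ
  set V : ℝ := (r : ℝ) ^ 2 * (L : ℝ) ^ 2 * Real.log ((r : ℝ) * (L : ℝ)) with hV
  have hwR : (2 : ℝ) ≤ (r : ℝ) * L := by exact_mod_cast hw
  have hV1 : 1 ≤ 60 * V := by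
    have h1 := Real.log_le_log two_pos hwR
    have h2 := Real.log_two_gt_d9
    have h3 : (4 : ℝ) * 0.69 ≤ ((r : ℝ) * L) ^ 2 * Real.log ((r : ℝ) * L) :=
      mul_le_mul (by nlinarith) (by linarith) (by norm_num) (by positivity)
    rw [hV, ← mul_pow]
    linarith
  have hV0 : 0 < V := by linarith
  set t : ℝ := (60 * V) ^ ((p : ℝ)⁻¹) with ht
  have ht1 : 1 ≤ t := Real.one_le_rpow hV1 (by positivity)
  have htp : t ^ p = 60 * V := Real.rpow_inv_natCast_pow (by linarith) hp.ne'
  set k := ⌊t⌋₊ + 1 with hk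
  have hkt : t < k := by rw [hk]; push_cast; exact Nat.lt_floor_add_one t
  have hk2 : (k : ℝ) ≤ 2 * t := by
    have := Nat.floor_le (show 0 ≤ t by linarith)
    rw [hk]; push_cast; linarith
  obtain ⟨f, hf, hfφ⟩ := ReluLowerBound.exists_le_supDist (β := β) hL hr hpr hw
    (Nat.succ_pos _) (ha k (Nat.succ_pos _)) (by
      rw [← hV, ← htp]
      exact pow_lt_pow_left₀ hkt (by linarith) hp.ne')
  refine ⟨f, hf, fun φ hφ => ?_⟩
  have htβ : (t ^ β)⁻¹ = (60 : ℝ) ^ (-(β : ℝ) / p) * V ^ (-(β : ℝ) / p) := by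
    rw [← Real.mul_rpow (by norm_num) hV0.le, ht, ← Real.rpow_natCast, ← Real.rpow_mul (by linarith),
      ← Real.rpow_neg (by linarith)]
    congr 1
    field_simp
  calc a / 2 ^ β * (60 : ℝ) ^ (-(β : ℝ) / p) * V ^ (-(β : ℝ) / p) - δ
      ≤ a / 2 ^ β * ((60 : ℝ) ^ (-(β : ℝ) / p) * V ^ (-(β : ℝ) / p)) := by linarith
    _ = a / (2 * t) ^ β := by rw [← htβ, mul_pow]; field_simp
    _ ≤ a / (k : ℝ) ^ β := by gcongr
    _ ≤ supDist p f φ := hfφ φ hφ
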